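/- Let γ > 1, c₀ > 0, and let n : [0,1] → ℝ be a positive smooth function with n''(t) > 0 on [0,1], n'(t) < 0 for t ∈ (0,1), n'(1) = 0, and n(1) = 1. Set b₁ = √(2c₀/(γ+1)) and let b₀ ∈ (0, b₁) be the unique solution of b₀^{γ−1}(c₀ − ((γ−1)/2)b₀²) n(0)^{γ−1} = b₁^{γ+1}. Let B : ℝ → ℝ be a positive, 2π-periodic function which is not identically equal to b₀² and which satisfies either B(y) ≥ b₀² for all y or B(y) ≤ b₀² for all y. Then there is no C² function φ : [0,1] × ℝ → ℝ, 2π-periodic in y, satisfying the potential flow equation n(x)²(c² − (∂₁φ)²)∂₁₁φ − 2∂₁φ ∂₂φ ∂₁₂φ + (c² − (∂₂φ)²/n(x)²)∂₂₂φ + n(x)n'(x)(c² + (∂₂φ)²/n(x)²)∂₁φ = 0 in (0,1) × ℝ, where c² = c₀ − ((γ−1)/2)((∂₁φ)² + (∂₂φ)²/n(x)²), together with: ∂₁φ ≥ 0 on {x=0} and {x=1}; (∂₁φ)² + (∂₂φ)²/n(0)² = B(y) on {x=0}; (∂₁φ)² + (∂₂φ)² = b₁² on {x=1}; and ∂₁₁φ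 > 0 on {x=1}. -/

import Mathlib

open Set

/-- The coordinate domain of the approximate nozzle: `[0,1] × ℝ` (periodic in `y`). -/
def nozzle : Set (ℝ × ℝ) := Set.Icc (0:ℝ) 1 ×ˢ (Set.univ : Set ℝ)

/-- `∂₁φ`, computed within the nozzle. -/
noncomputable def pd1 (φ : ℝ × ℝ → ℝ) (p : ℝ × ℝ) : ℝ :=
  fderivWithin ℝ φ nozzle p (1, 0)

/-- `∂₂φ`, computed within the nozzle. -/
noncomputable def pd2 (φ : ℝ × ℝ → ℝ) (p : ℝ × ℝ) : ℝ :=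
  fderivWithin ℝ φ nozzle p (0, 1)

/-- `∂₁₁φ`. -/
noncomputable def pd11 (φ : ℝ × ℝ → ℝ) (p : ℝ × ℝ) : ℝ :=
  fderivWithin ℝ (pd1 φ) nozzle p (1, 0)

/-- `∂₁₂φ`. -/
noncomputable def pd12 (φ : ℝ × ℝ → ℝ) (p : ℝ × ℝ) : ℝ :=
  fderivWithin ℝ (pd2 φ) nozzle p (1, 0)

/-- `∂₂₂φ`. -/
noncomputable def pd22 (φ : ℝ × ℝ → ℝ) (p : ℝ × ℝ) : ℝ :=
  fderivWithin ℝ (pd2 φ) nozzle p (0, 1)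

/-- The squared sound speed `c² = c₀ − ((γ−1)/2)((∂₁φ)² + (∂₂φ)²/n(x)²)` from Bernoulli's law. -/
noncomputable def soundSq (γ c₀ : ℝ) (n : ℝ → ℝ) (φ : ℝ × ℝ → ℝ) (p : ℝ × ℝ) : ℝ :=
  c₀ - (γ - 1) / 2 * ((pd1 φ p) ^ 2 + (pd2 φ p) ^ 2 / (n p.1) ^ 2)

/-- The potential flow equation at the point `p`. -/
def PotentialFlowEq (γ c₀ : ℝ) (n : ℝ → ℝ) (φ : ℝ × ℝ → ℝ) (p : ℝ × ℝ) : Prop :=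
  (n p.1) ^ 2 * (soundSq γ c₀ n φ p - (pd1 φ p) ^ 2) * pd11 φ p
    - 2 * pd1 φ p * pd2 φ p * pd12 φ p
    + (soundSq γ c₀ n φ p - (pd2 φ p) ^ 2 / (n p.1) ^ 2) * pd22 φ p
    + n p.1 * deriv n p.1 * (soundSq γ c₀ n φ p + (pd2 φ p) ^ 2 / (n p.1) ^ 2) * pd1 φ p = 0

open Topology

theorem nonpos_of_isMaxOn_left {f : ℝ → ℝ} {a b d : ℝ} (hab : a < b)
    (hd : HasDerivWithinAt f d (Icc a b) a) (hmax : IsMaxOn f (Icc a b) a) : d ≤ 0 := by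
  have h := (IsMaxOn.localize hmax).hasFDerivWithinAt_nonpos hd.hasFDerivWithinAt
    (mem_posTangentConeAt_of_segment_subset (y := b - a) (by
      rw [add_sub_cancel, segment_eq_Icc hab.le]))
  simp only [ContinuousLinearMap.toSpanSingleton_apply, smul_eq_mul] at h
  nlinarith

theorem nonneg_of_isMaxOn_right {f : ℝ → ℝ} {a b d : ℝ} (hab : a < b)
    (hd : HasDerivWithinAt f d (Icc a b) b) (hmax : IsMaxOn f (Icc a b) b) : 0 ≤ d := by
  have h := (IsMaxOn.localize hmax).hasFDerivWithinAt_nonpos hd.hasFDerivWithinAt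
    (mem_posTangentConeAt_of_segment_subset (y := a - b) (by
      rw [add_sub_cancel, segment_symm, segment_eq_Icc hab.le]))
  simp only [ContinuousLinearMap.toSpanSingleton_apply, smul_eq_mul] at h
  nlinarith

theorem IsLocalMax.second_deriv_nonpos {f f' : ℝ → ℝ} {a d : ℝ} (hmax : IsLocalMax f a)
    (hf : ∀ᶠ t in 𝓝 a, HasDerivAt f (f' t) t) (hf' : HasDerivAt f' d a) : d ≤ 0 := by
  by_contra! hd
  have hev : deriv f =ᶠ[𝓝 a] f' := hf.mono fun t ht => ht.deriv
  have hfa := hf.self_of_nhds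
  have hmin : IsLocalMin f a := by
    refine isLocalMin_of_deriv_deriv_pos ?_ ?_ hfa.continuousAt
    · rwa [hev.deriv_eq, hf'.deriv]
    · rw [hfa.deriv, hmax.hasDerivAt_eq_zero hfa]
  have hconst : f =ᶠ[𝓝 a] fun _ => f a := by
    filter_upwards [hmin, hmax] with t h1 h2 using le_antisymm h2 h1
  have hzero : f' =ᶠ[𝓝 a] fun _ => (0 : ℝ) := by
    filter_upwards [hconst.eventuallyEq_nhds, hf] with t h1 h2
    exact h2.unique ((hasDerivAt_const t (f a)).congr_of_eventuallyEq h1)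
  have := hf'.unique ((hasDerivAt_const a (0 : ℝ)).congr_of_eventuallyEq hzero)
  exact hd.ne' this

/-- `W` solves, on the nozzle, a linear equation in diagonal form without zeroth-order term,
elliptic away from the exit. -/
structure IsEllipticSolution (W Wx Wy Wxx Wyy P R : ℝ × ℝ → ℝ) (a b : ℝ → ℝ) : Prop where
  cont : ContinuousOn W nozzle
  periodic : ∀ x y, W (x, y + 2 * Real.pi) = W (x, y)
  deriv_x : ∀ x ∈ Icc (0 : ℝ) 1, ∀ y, HasDerivWithinAt (fun t => W (t, y)) (Wx (x, y)) (Icc 0 1) x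
  deriv_y : ∀ x ∈ Icc (0 : ℝ) 1, ∀ y, HasDerivAt (fun t => W (x, t)) (Wy (x, y)) y
  deriv_xx : ∀ x ∈ Ioo (0 : ℝ) 1, ∀ y, HasDerivAt (fun t => Wx (t, y)) (Wxx (x, y)) x
  deriv_yy : ∀ x ∈ Ioo (0 : ℝ) 1, ∀ y, HasDerivAt (fun t => Wy (x, t)) (Wyy (x, y)) y
  eqn : ∀ x ∈ Ioo (0 : ℝ) 1, ∀ y,
    a x * Wxx (x, y) + b x * Wyy (x, y) + P (x, y) * Wx (x, y) + R (x, y) * Wy (x, y) = 0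
  cont_a : ContinuousOn a (Icc 0 1)
  pos_a : ∀ x ∈ Ico (0 : ℝ) 1, 0 < a x
  cont_b : ContinuousOn b (Icc 0 1)
  pos_b : ∀ x ∈ Ico (0 : ℝ) 1, 0 < b x
  cont_P : ContinuousOn P nozzle
  cont_R : ContinuousOn R nozzle

theorem isCompact_rect (a b c d : ℝ) : IsCompact (Icc a b ×ˢ Icc c d : Set (ℝ × ℝ)) :=
  isCompact_Icc.prod isCompact_Icc

theorem rect_subset_nozzle {a b : ℝ} (ha : 0 ≤ a) (hb : b ≤ 1) (c d : ℝ) :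
    (Icc a b ×ˢ Icc c d : Set (ℝ × ℝ)) ⊆ nozzle :=
  prod_mono (Icc_subset_Icc ha hb) (subset_univ _)

/-- Continuous functions that are negative on one period of the exit are negative near it. -/
theorem neg_near_exit {F : ℝ × ℝ → ℝ} (hF : ContinuousOn F nozzle)
    (hneg : ∀ y ∈ Icc 0 (2 * Real.pi), F (1, y) < 0) :
    ∃ δ ∈ Ioo (0 : ℝ) 1, ∀ x ∈ Icc (1 - δ) 1, ∀ y ∈ Icc 0 (2 * Real.pi), F (x, y) < 0 := by
  have hsub := rect_subset_nozzle (le_refl (0 : ℝ)) (le_refl (1 : ℝ)) 0 (2 * Real.pi)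
  obtain ⟨y₀, hy₀, hmax⟩ := (isCompact_Icc (a := (0 : ℝ)) (b := 2 * Real.pi)).exists_isMaxOn
    (nonempty_Icc.2 Real.two_pi_pos.le) (f := fun y => F (1, y))
    (hF.comp (by fun_prop) fun y _ => ⟨⟨zero_le_one, le_rfl⟩, mem_univ _⟩)
  have huc := (isCompact_rect 0 1 0 (2 * Real.pi)).uniformContinuousOn_of_continuous (hF.mono hsub)
  obtain ⟨δ, hδ, h⟩ := Metric.uniformContinuousOn_iff.1 huc (-F (1, y₀)) (by linarith [hneg y₀ hy₀])
  refine ⟨min (δ / 2) (1 / 2), ⟨by positivity, ?_⟩, fun x hx y hy => ?_⟩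
  · exact (min_le_right _ _).trans_lt (by norm_num)
  have h1 := min_le_left (δ / 2) (1 / 2)
  have h2 := min_le_right (δ / 2) (1 / 2)
  have := h (x, y) ⟨⟨by linarith [hx.1], hx.2⟩, hy⟩ (1, y) ⟨⟨zero_le_one, le_rfl⟩, hy⟩ (by
    rw [dist_prod_same_right, Real.dist_eq, abs_lt]
    constructor <;> linarith [hx.1, hx.2])
  rw [Real.dist_eq, abs_lt] at this
  have h3 : F (1, y) ≤ F (1, y₀) := hmax hy
  linarith

theorem exists_mem_Icc_period (f : ℝ → ℝ) (hf : ∀ y, f (y + 2 * Real.pi) = f y) (y : ℝ) :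
    ∃ z ∈ Icc 0 (2 * Real.pi), f y = f z := by
  obtain ⟨z, hz, h⟩ := Function.Periodic.exists_mem_Ico₀ (f := f) hf Real.two_pi_pos y
  exact ⟨z, ⟨hz.1, hz.2.le⟩, h⟩

/-- Periodic functions attain their maximum over a closed substrip of the nozzle. -/
theorem exists_strip_max {F : ℝ × ℝ → ℝ} {a b : ℝ} (ha : 0 ≤ a) (hab : a ≤ b) (hb : b ≤ 1)
    (hF : ContinuousOn F nozzle) (hper : ∀ x y, F (x, y + 2 * Real.pi) = F (x, y)) :
    ∃ x₀ ∈ Icc a b, ∃ y₀ ∈ Icc 0 (2 * Real.pi), ∀ x ∈ Icc a b, ∀ y, F (x, y) ≤ F (x₀, y₀) := by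
  obtain ⟨⟨x₀, y₀⟩, h0, hmax⟩ := (isCompact_rect a b 0 (2 * Real.pi)).exists_isMaxOn
    ((nonempty_Icc.2 hab).prod (nonempty_Icc.2 Real.two_pi_pos.le))
    (hF.mono (rect_subset_nozzle ha hb _ _))
  refine ⟨x₀, h0.1, y₀, h0.2, fun x hx y => ?_⟩
  obtain ⟨z, hz, h⟩ := exists_mem_Icc_period (fun t => F (x, t)) (hper x) y
  exact h.trans_le (hmax (show (x, z) ∈ _ from ⟨hx, hz⟩))

namespace IsEllipticSolution

variable {W Wx Wy Wxx Wyy P R : ℝ × ℝ → ℝ} {a b : ℝ → ℝ}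

theorem deriv_x_interior (S : IsEllipticSolution W Wx Wy Wxx Wyy P R a b) {x : ℝ}
    (hx : x ∈ Ioo (0 : ℝ) 1) (y : ℝ) : HasDerivAt (fun t => W (t, y)) (Wx (x, y)) x :=
  (S.deriv_x x ⟨hx.1.le, hx.2.le⟩ y).hasDerivAt (Icc_mem_nhds hx.1 hx.2)

/-- A strict subsolution added to `W` prevents interior maxima. -/
theorem no_interior_max (S : IsEllipticSolution W Wx Wy Wxx Wyy P R a b) {x y : ℝ}
    (hx : x ∈ Ioo (0 : ℝ) 1) {H Hx Hy : ℝ × ℝ → ℝ} {Hxx Hyy : ℝ}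
    (hHx : ∀ t, HasDerivAt (fun t => H (t, y)) (Hx (t, y)) t)
    (hHy : ∀ t, HasDerivAt (fun t => H (x, t)) (Hy (x, t)) t)
    (hHxx : HasDerivAt (fun t => Hx (t, y)) Hxx x)
    (hHyy : HasDerivAt (fun t => Hy (x, t)) Hyy y)
    (hL : 0 < a x * Hxx + b x * Hyy + P (x, y) * Hx (x, y) + R (x, y) * Hy (x, y))
    (hmx : IsLocalMax (fun t => W (t, y) + H (t, y)) x)
    (hmy : IsLocalMax (fun t => W (x, t) + H (x, t)) y) : False := by
  have hxc : x ∈ Icc (0 : ℝ) 1 := ⟨hx.1.le, hx.2.le⟩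
  have e1 := hmx.hasDerivAt_eq_zero ((S.deriv_x_interior hx y).add (hHx x))
  have e2 := hmy.hasDerivAt_eq_zero ((S.deriv_y x hxc y).add (hHy y))
  have e3 := hmx.second_deriv_nonpos (f' := fun t => Wx (t, y) + Hx (t, y))
    (Filter.mem_of_superset (Ioo_mem_nhds hx.1 hx.2) fun t ht =>
      (S.deriv_x_interior ht y).add (hHx t))
    ((S.deriv_xx x hx y).add hHxx)
  have e4 := hmy.second_deriv_nonpos (f' := fun t => Wy (x, t) + Hy (x, t))
    (Filter.Eventually.of_forall fun t => (S.deriv_y x hxc t).add (hHy t))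
    ((S.deriv_yy x hx y).add hHyy)
  have ha := S.pos_a x ⟨hx.1.le, hx.2⟩
  have hb := S.pos_b x ⟨hx.1.le, hx.2⟩
  have e5 := mul_nonpos_of_nonneg_of_nonpos ha.le e3
  have e6 := mul_nonpos_of_nonneg_of_nonpos hb.le e4
  have e7 : P (x, y) * (Wx (x, y) + Hx (x, y)) = 0 := by rw [e1, mul_zero]
  have e8 : R (x, y) * (Wy (x, y) + Hy (x, y)) = 0 := by rw [e2, mul_zero]
  linarith [S.eqn x hx y]

/-- With the entry condition, the maximum of `W` over `[0, x₁]` is attained at `x = x₁`. -/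
theorem le_of_le_line (S : IsEllipticSolution W Wx Wy Wxx Wyy P R a b)
    (hentry : ∀ y, Wy (0, y) = 0 → 0 ≤ Wx (0, y)) {x₁ M : ℝ} (hx₁ : x₁ ∈ Ioo (0 : ℝ) 1)
    (hM : ∀ y, W (x₁, y) ≤ M) {x : ℝ} (hx : x ∈ Icc 0 x₁) (y : ℝ) : W (x, y) ≤ M := by
  by_contra! hlt
  obtain ⟨k, hk0, hk⟩ : ∃ k > 0, ∀ t ∈ Icc 0 x₁, ∀ u ∈ Icc 0 (2 * Real.pi),
      0 < a t * k + P (t, u) := by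
    obtain ⟨t₀, ht₀, hmin⟩ := (isCompact_Icc (a := 0) (b := x₁)).exists_isMinOn
      (nonempty_Icc.2 hx₁.1.le) (S.cont_a.mono (Icc_subset_Icc_right hx₁.2.le))
    obtain ⟨p₀, hp₀, hminP⟩ := (isCompact_rect 0 x₁ 0 (2 * Real.pi)).exists_isMinOn
      ((nonempty_Icc.2 hx₁.1.le).prod (nonempty_Icc.2 Real.two_pi_pos.le))
      (S.cont_P.mono (rect_subset_nozzle le_rfl hx₁.2.le _ _))
    have ha := S.pos_a t₀ ⟨ht₀.1, ht₀.2.trans_lt hx₁.2⟩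
    refine ⟨(|P p₀| + 1) / a t₀, by positivity, fun t ht u hu => ?_⟩
    have h1 : a t₀ ≤ a t := hmin ht
    have h2 : P p₀ ≤ P (t, u) := hminP (show (t, u) ∈ _ from ⟨ht, hu⟩)
    have h3 : |P p₀| + 1 ≤ a t * ((|P p₀| + 1) / a t₀) := by
      calc |P p₀| + 1 = a t₀ * ((|P p₀| + 1) / a t₀) := by field_simp
        _ ≤ _ := by gcongr
    linarith [neg_abs_le (P p₀)]
  set ε := (W (x, y) - M) / (2 * Real.exp k) with hε
  have hε0 : 0 < ε := div_pos (by linarith) (by positivity)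
  set F : ℝ × ℝ → ℝ := fun p => W p + ε * Real.exp (k * p.1) with hF
  obtain ⟨ξ, hξ, η, hη, hmax⟩ := exists_strip_max (F := F) le_rfl hx₁.1.le hx₁.2.le
    (S.cont.add (by fun_prop)) (fun x y => by simp [hF, S.periodic])
  have hbig : M + ε * Real.exp k < F (ξ, η) := by
    have h1 := hmax x hx y
    have h2 : ε * Real.exp k = (W (x, y) - M) / 2 := by rw [hε]; field_simp
    have h3 : 0 < ε * Real.exp (k * x) := by positivity
    simp only [hF] at h1 ⊢
    linarith
  have hξ1 : ξ < x₁ := by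
    refine lt_of_le_of_ne hξ.2 fun h => ?_
    have h1 : Real.exp (k * ξ) ≤ Real.exp k :=
      Real.exp_le_exp.2 (by nlinarith [hξ.2, hx₁.2])
    have h2 := hM η
    rw [← h] at h2
    have h3 := mul_le_mul_of_nonneg_left h1 hε0.le
    simp only [hF] at hbig
    linarith
  have hder : ∀ t, HasDerivAt (fun t => ε * Real.exp (k * t)) (ε * k * Real.exp (k * t)) t := by
    intro t
    have := (((hasDerivAt_id t).const_mul k).exp).const_mul ε
    exact this.congr_deriv (by simp only [id_eq]; ring)
  have hmy : IsLocalMax (fun t => F (ξ, t)) η := Filter.Eventually.of_forall fun t => hmax ξ hξ t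
  rcases hξ.1.eq_or_lt with h0 | h0
  · subst h0
    have hWy : Wy (0, η) = 0 :=
      hmy.hasDerivAt_eq_zero
        ((S.deriv_y 0 ⟨le_rfl, zero_le_one⟩ η).add_const (ε * Real.exp (k * 0)))
    have hd := ((S.deriv_x 0 ⟨le_rfl, zero_le_one⟩ η).mono (Icc_subset_Icc_right hx₁.2.le)).add
      (hder 0).hasDerivWithinAt
    have := nonpos_of_isMaxOn_left hx₁.1 hd (fun t ht => hmax t ht η)
    have h2 := hentry η hWy
    have h3 : 0 < ε * k * Real.exp (k * 0) := by positivity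
    linarith
  · refine S.no_interior_max ⟨h0, hξ1.trans hx₁.2⟩ (H := fun p => ε * Real.exp (k * p.1))
      (Hx := fun p => ε * k * Real.exp (k * p.1)) (Hy := fun _ => 0)
      (Hxx := ε * k * (k * Real.exp (k * ξ))) (Hyy := 0) hder
      (fun t => hasDerivAt_const t (ε * Real.exp (k * ξ)))
      ?_ (hasDerivAt_const _ _) ?_ ?_ hmy
    · have := (((hasDerivAt_id ξ).const_mul k).exp).const_mul (ε * k)
      exact this.congr_deriv (by simp only [id_eq]; ring)
    · have := hk ξ ⟨h0.le, hξ1.le⟩ η hη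
      have h4 : 0 < ε * k * Real.exp (k * ξ) * (a ξ * k + P (ξ, η)) := by positivity
      simp only
      linarith
    · exact Filter.mem_of_superset (Icc_mem_nhds h0 hξ1) fun t ht => hmax t ht η

theorem nonpos (S : IsEllipticSolution W Wx Wy Wxx Wyy P R a b)
    (hentry : ∀ y, Wy (0, y) = 0 → 0 ≤ Wx (0, y)) (hexit : ∀ y, W (1, y) = 0)
    {x : ℝ} (hx : x ∈ Icc (0 : ℝ) 1) (y : ℝ) : W (x, y) ≤ 0 := by
  rcases hx.2.eq_or_lt with rfl | hx1
  · exact (hexit y).le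
  refine le_of_forall_pos_le_add fun c hc => ?_
  obtain ⟨δ, hδ, h⟩ := neg_near_exit (F := fun p => W p - c) (S.cont.sub (by fun_prop))
    (fun y _ => by simp only [hexit, zero_sub]; linarith)
  have hδ0 := hδ.1
  have hδ1 := hδ.2
  refine S.le_of_le_line hentry (x₁ := max x (1 - δ))
    ⟨lt_max_of_lt_right (by linarith), max_lt hx1 (by linarith)⟩ (fun y => ?_)
    ⟨hx.1, le_max_left _ _⟩ y
  obtain ⟨z, hz, hyz⟩ := exists_mem_Icc_period (fun t => W (max x (1 - δ), t)) (S.periodic _) y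
  have := h (max x (1 - δ)) ⟨le_max_right _ _, max_le hx1.le (by linarith)⟩ z hz
  linarith

/-- Strong maximum principle. -/
theorem neg_of_neg (S : IsEllipticSolution W Wx Wy Wxx Wyy P R a b)
    (hW : ∀ x ∈ Icc (0 : ℝ) 1, ∀ y, W (x, y) ≤ 0) {x₀ y₀ x₁ y₁ : ℝ}
    (hneg : W (x₀, y₀) < 0) (h0 : |x₁ - x₀| < x₀) (h1 : |x₁ - x₀| < 1 - x₀) :
    W (x₁, y₁) < 0 := by
  obtain ⟨α, hα1, hα2⟩ := exists_between (lt_min h0 h1)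
  obtain ⟨hα0, hα1'⟩ := lt_min_iff.1 hα2
  have hαpos : 0 < α := (abs_nonneg _).trans_lt hα1
  obtain ⟨β, hβpos, hβ⟩ : ∃ β > 0, ((x₁ - x₀) / α) ^ 2 + ((y₁ - y₀) / β) ^ 2 < 1 := by
    have hlt : ((x₁ - x₀) / α) ^ 2 < 1 := by
      rw [sq_lt_one_iff_abs_lt_one, abs_div, abs_of_pos hαpos, div_lt_one hαpos]
      exact hα1
    have hlim : Filter.Tendsto (fun β : ℝ => ((x₁ - x₀) / α) ^ 2 + ((y₁ - y₀) / β) ^ 2)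
        Filter.atTop (𝓝 (((x₁ - x₀) / α) ^ 2 + 0 ^ 2)) :=
      ((Filter.tendsto_id.const_div_atTop _).pow 2).const_add _
    obtain ⟨β, h1, h2⟩ := ((hlim.eventually_lt_const (by rwa [zero_pow two_ne_zero, add_zero])).and
      (Filter.eventually_gt_atTop 0)).exists
    exact ⟨β, h2, h1⟩
  set f : ℝ × ℝ → ℝ := fun p => ((p.1 - x₀) / α) ^ 2 + ((p.2 - y₀) / β) ^ 2 with hf
  set K : Set (ℝ × ℝ) := Icc (x₀ - α) (x₀ + α) ×ˢ Icc (y₀ - β) (y₀ + β) with hK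
  have hKn : K ⊆ nozzle := rect_subset_nozzle (by linarith) (by linarith) _ _
  have hKI : ∀ p ∈ K, p.1 ∈ Ioo (0 : ℝ) 1 := fun p hp =>
    ⟨by linarith [hp.1.1], by linarith [hp.1.2]⟩
  have hKc : IsCompact K := isCompact_rect _ _ _ _
  have hmaps : MapsTo Prod.fst K (Icc (0 : ℝ) 1) := fun p hp =>
    ⟨(hKI p hp).1.le, (hKI p hp).2.le⟩
  have haK : ContinuousOn (fun p : ℝ × ℝ => a p.1) K := S.cont_a.comp (by fun_prop) hmaps
  have hbK : ContinuousOn (fun p : ℝ × ℝ => b p.1) K := S.cont_b.comp (by fun_prop) hmaps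
  set ε := -W (x₀, y₀) / 2 with hε
  have hε0 : 0 < ε := by linarith
  -- the part of the rectangle away from the centre
  set K' : Set (ℝ × ℝ) := K ∩ W ⁻¹' Ici (-ε) with hK'
  have hK'c : IsCompact K' :=
    hKc.of_isClosed_subset
      ((S.cont.mono hKn).preimage_isClosed_of_isClosed hKc.isClosed isClosed_Ici)
      inter_subset_left
  set fx : ℝ × ℝ → ℝ := fun p => 2 * (p.1 - x₀) / α ^ 2 with hfx
  set fy : ℝ × ℝ → ℝ := fun p => 2 * (p.2 - y₀) / β ^ 2 with hfy
  obtain ⟨k, hk0, hk⟩ : ∃ k > 0, ∀ p ∈ K', 0 < k * (a p.1 * fx p ^ 2 + b p.1 * fy p ^ 2) -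
      (a p.1 * (2 / α ^ 2) + b p.1 * (2 / β ^ 2) + P p * fx p + R p * fy p) := by
    rcases K'.eq_empty_or_nonempty with hemp | hne
    · exact ⟨1, one_pos, by simp [hemp]⟩
    have hsub : K' ⊆ K := inter_subset_left
    have ca := haK.mono hsub
    have cb := hbK.mono hsub
    have cP := S.cont_P.mono (hsub.trans hKn)
    have cR := S.cont_R.mono (hsub.trans hKn)
    have cfx : ContinuousOn fx K' := by fun_prop
    have cfy : ContinuousOn fy K' := by fun_prop
    obtain ⟨p₀, hp₀, hmin⟩ := hK'c.exists_isMinOn hne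
      ((ca.mul (cfx.pow 2)).add (cb.mul (cfy.pow 2)))
    obtain ⟨q₀, hq₀, hmax⟩ := hK'c.exists_isMaxOn hne
      ((((ca.mul (continuousOn_const (c := 2 / α ^ 2))).add
        (cb.mul (continuousOn_const (c := 2 / β ^ 2)))).add (cP.mul cfx)).add (cR.mul cfy))
    set m := a p₀.1 * fx p₀ ^ 2 + b p₀.1 * fy p₀ ^ 2 with hm
    set T := a q₀.1 * (2 / α ^ 2) + b q₀.1 * (2 / β ^ 2) + P q₀ * fx q₀ + R q₀ * fy q₀ with hT
    have hmpos : 0 < m := by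
      have hI := hKI p₀ hp₀.1
      have ha := S.pos_a p₀.1 ⟨hI.1.le, hI.2⟩
      have hb := S.pos_b p₀.1 ⟨hI.1.le, hI.2⟩
      by_cases hx : p₀.1 = x₀
      · have hy : p₀.2 - y₀ ≠ 0 := fun hy => by
          have hp : p₀ = (x₀, y₀) := Prod.ext hx (by simp only; linarith)
          have : -ε ≤ W p₀ := hp₀.2
          rw [hp] at this
          linarith
        have : 0 < fy p₀ ^ 2 := by simp only [hfy]; positivity
        have := mul_pos hb this
        have : 0 ≤ a p₀.1 * fx p₀ ^ 2 := by positivity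
        linarith
      · have hx : p₀.1 - x₀ ≠ 0 := sub_ne_zero.2 hx
        have : 0 < fx p₀ ^ 2 := by simp only [hfx]; positivity
        have := mul_pos ha this
        have : 0 ≤ b p₀.1 * fy p₀ ^ 2 := by positivity
        linarith
    refine ⟨(|T| + 1) / m, by positivity, fun p hp => ?_⟩
    have h1 : m ≤ a p.1 * fx p ^ 2 + b p.1 * fy p ^ 2 := hmin hp
    have h2 : a p.1 * (2 / α ^ 2) + b p.1 * (2 / β ^ 2) + P p * fx p + R p * fy p ≤ T := hmax hp
    have h3 : |T| + 1 ≤ (|T| + 1) / m * (a p.1 * fx p ^ 2 + b p.1 * fy p ^ 2) := by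
      calc |T| + 1 = (|T| + 1) / m * m := by field_simp
        _ ≤ _ := by gcongr
    linarith [le_abs_self T]
  set H : ℝ × ℝ → ℝ := fun p => ε * (Real.exp (-k * f p) - Real.exp (-k)) with hH
  have hHc : Continuous H := by fun_prop
  obtain ⟨⟨ξ, η⟩, hp, hmax⟩ := hKc.exists_isMaxOn
    ⟨(x₀, y₀), ⟨⟨by linarith, by linarith⟩, ⟨by linarith, by linarith⟩⟩⟩
    ((S.cont.mono hKn).add hHc.continuousOn)
  have hle : W (ξ, η) + H (ξ, η) ≤ 0 := by
    by_contra! hpos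
    have hWle : W (ξ, η) ≤ 0 := hW ξ ⟨(hKI _ hp).1.le, (hKI _ hp).2.le⟩ η
    have hHpos : 0 < H (ξ, η) := by linarith
    have hf1 : f (ξ, η) < 1 := by
      have h2 : Real.exp (-k) < Real.exp (-k * f (ξ, η)) := by
        by_contra! hcon
        have : H (ξ, η) ≤ 0 := mul_nonpos_of_nonneg_of_nonpos hε0.le (by linarith)
        linarith
      rw [Real.exp_lt_exp] at h2
      nlinarith
    have hp' : (ξ, η) ∈ K' := by
      refine ⟨hp, ?_⟩
      have h2 : Real.exp (-k * f (ξ, η)) ≤ 1 := by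
        rw [Real.exp_le_one_iff]
        have : 0 ≤ f (ξ, η) := by simp only [hf]; positivity
        nlinarith
      have h3 : H (ξ, η) ≤ ε * 1 :=
        mul_le_mul_of_nonneg_left (by linarith [Real.exp_pos (-k)]) hε0.le
      simp only [mem_preimage, mem_Ici]
      linarith
    have hξ : |ξ - x₀| < α := by
      have : ((ξ - x₀) / α) ^ 2 < 1 := by
        have := sq_nonneg ((η - y₀) / β)
        simp only [hf] at hf1; linarith
      rwa [sq_lt_one_iff_abs_lt_one, abs_div, abs_of_pos hαpos, div_lt_one hαpos] at this
    have hη : |η - y₀| < β := by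
      have : ((η - y₀) / β) ^ 2 < 1 := by
        have := sq_nonneg ((ξ - x₀) / α)
        simp only [hf] at hf1; linarith
      rwa [sq_lt_one_iff_abs_lt_one, abs_div, abs_of_pos hβpos, div_lt_one hβpos] at this
    rw [abs_lt] at hξ hη
    have dfx : ∀ t u, HasDerivAt (fun t => f (t, u)) (fx (t, u)) t := fun t u => by
      have := ((((hasDerivAt_id t).sub_const x₀).div_const α).pow 2).add_const (((u - y₀) / β) ^ 2)
      exact this.congr_deriv (by simp [hfx]; field_simp)
    have dfy : ∀ t u, HasDerivAt (fun u => f (t, u)) (fy (t, u)) u := fun t u => by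
      have := ((((hasDerivAt_id u).sub_const y₀).div_const β).pow 2).const_add (((t - x₀) / α) ^ 2)
      exact this.congr_deriv (by simp [hfy]; field_simp)
    have dfxx : HasDerivAt (fun t => fx (t, η)) (2 / α ^ 2) ξ := by
      have := (((hasDerivAt_id ξ).sub_const x₀).const_mul 2).div_const (α ^ 2)
      exact this.congr_deriv (by simp)
    have dfyy : HasDerivAt (fun t => fy (ξ, t)) (2 / β ^ 2) η := by
      have := (((hasDerivAt_id η).sub_const y₀).const_mul 2).div_const (β ^ 2)
      exact this.congr_deriv (by simp)
    have dEx : ∀ t u, HasDerivAt (fun t => Real.exp (-k * f (t, u)))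
        (Real.exp (-k * f (t, u)) * (-k * fx (t, u))) t := fun t u =>
      ((dfx t u).const_mul (-k)).exp
    have dEy : ∀ t u, HasDerivAt (fun u => Real.exp (-k * f (t, u)))
        (Real.exp (-k * f (t, u)) * (-k * fy (t, u))) u := fun t u =>
      ((dfy t u).const_mul (-k)).exp
    refine S.no_interior_max (hKI _ hp) (H := H)
      (Hx := fun p => ε * (Real.exp (-k * f p) * (-k * fx p)))
      (Hy := fun p => ε * (Real.exp (-k * f p) * (-k * fy p)))
      (fun t => ((dEx t η).sub_const _).const_mul ε) (fun t => ((dEy ξ t).sub_const _).const_mul ε)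
      (((dEx ξ η).mul (dfxx.const_mul (-k))).const_mul ε)
      (((dEy ξ η).mul (dfyy.const_mul (-k))).const_mul ε) ?_ ?_ ?_
    · have h5 : 0 < ε * Real.exp (-k * f (ξ, η)) * k *
          (k * (a ξ * fx (ξ, η) ^ 2 + b ξ * fy (ξ, η) ^ 2) -
          (a ξ * (2 / α ^ 2) + b ξ * (2 / β ^ 2) + P (ξ, η) * fx (ξ, η) + R (ξ, η) * fy (ξ, η))) :=
        mul_pos (by positivity) (hk _ hp')
      refine h5.trans_eq ?_
      ring
    · refine Filter.mem_of_superset (Icc_mem_nhds (a := x₀ - α) (b := x₀ + α) (by linarith)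
        (by linarith)) fun t ht => ?_
      exact hmax (show (t, η) ∈ K from ⟨ht, hp.2⟩)
    · refine Filter.mem_of_superset (Icc_mem_nhds (a := y₀ - β) (b := y₀ + β) (by linarith)
        (by linarith)) fun t ht => ?_
      exact hmax (show (ξ, t) ∈ K from ⟨hp.1, ht⟩)
  have hmem : (x₁, y₁) ∈ K := by
    have hy : |y₁ - y₀| < β := by
      have : ((y₁ - y₀) / β) ^ 2 < 1 := by linarith [sq_nonneg ((x₁ - x₀) / α)]
      rwa [sq_lt_one_iff_abs_lt_one, abs_div, abs_of_pos hβpos, div_lt_one hβpos] at this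
    rw [abs_lt] at hy hα1
    exact ⟨⟨by linarith, by linarith⟩, ⟨by linarith, by linarith⟩⟩
  have h2 : W (x₁, y₁) + H (x₁, y₁) ≤ W (ξ, η) + H (ξ, η) := hmax hmem
  have h3 : 0 < H (x₁, y₁) := by
    refine mul_pos hε0 (sub_pos.2 (Real.exp_lt_exp.2 ?_))
    have : f (x₁, y₁) < 1 := hβ
    nlinarith
  linarith

/-- A point of degenerate Hopf type: if `Wx` vanishes at the exit, then `W` vanishes somewhere on
every line close to the exit. -/
theorem exists_zero_near_exit (S : IsEllipticSolution W Wx Wy Wxx Wyy P R a b)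
    (hW : ∀ x ∈ Icc (0 : ℝ) 1, ∀ y, W (x, y) ≤ 0) (hexit : ∀ y, W (1, y) = 0)
    (hexit_x : ∀ y, Wx (1, y) = 0) (hP : ∀ y, P (1, y) < 0) :
    ∃ x ∈ Ioo (0 : ℝ) 1, ∃ y, W (x, y) = 0 := by
  obtain ⟨δ, hδ, hPneg⟩ := neg_near_exit S.cont_P fun y _ => hP y
  have hδ0 := hδ.1
  have hδ1 := hδ.2
  by_contra! hne
  have hneg : ∀ y, W (1 - δ, y) < 0 := fun y =>
    lt_of_le_of_ne (hW _ ⟨by linarith, by linarith⟩ y) (hne _ ⟨by linarith, by linarith⟩ y)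
  obtain ⟨x', hx', y', hy', hmax'⟩ := exists_strip_max (a := 1 - δ) (b := 1 - δ) (by linarith)
    le_rfl (by linarith) S.cont S.periodic
  obtain rfl : x' = 1 - δ := le_antisymm hx'.2 hx'.1
  set ε := -W (1 - δ, y') / δ with hε
  have hε0 : 0 < ε := div_pos (by linarith [hneg y']) hδ0
  have hεδ : ε * δ = -W (1 - δ, y') := by rw [hε]; field_simp
  set F : ℝ × ℝ → ℝ := fun p => W p + ε * (1 - p.1) with hF
  obtain ⟨ξ, hξ, η, hη, hmax⟩ := exists_strip_max (F := F) (a := 1 - δ) (b := 1) (by linarith)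
    (by linarith) le_rfl (S.cont.add (by fun_prop)) (fun x y => by simp [hF, S.periodic])
  have hle : F (ξ, η) ≤ 0 := by
    by_contra! hpos
    have hξ1 : ξ ≠ 1 := by
      rintro rfl
      simp [hF, hexit] at hpos
    have hξ2 : 1 - δ ≠ ξ := by
      rintro rfl
      have := hmax' (1 - δ) hx' η
      simp only [hF] at hpos
      linarith
    have h1 := lt_of_le_of_ne hξ.2 hξ1
    have h2 := lt_of_le_of_ne hξ.1 hξ2
    have hder : ∀ t : ℝ, HasDerivAt (fun t => ε * (1 - t)) (-ε) t := fun t => by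
      simpa using ((hasDerivAt_id t).const_sub 1).const_mul ε
    refine S.no_interior_max ⟨by linarith, h1⟩ (H := fun p => ε * (1 - p.1))
      (Hx := fun _ => -ε) (Hy := fun _ => 0) hder
      (fun t => hasDerivAt_const t (ε * (1 - ξ)))
      (hasDerivAt_const _ _) (hasDerivAt_const _ _) ?_ ?_
      (Filter.Eventually.of_forall fun t => hmax ξ hξ t)
    · have := hPneg ξ hξ η hη
      nlinarith
    · exact Filter.mem_of_superset (Icc_mem_nhds h2 h1) fun t ht => hmax t ht η
  have hd : HasDerivWithinAt (fun t => F (t, 0)) (Wx (1, 0) + -ε) (Icc (1 - δ) 1) 1 := by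
    refine ((S.deriv_x 1 ⟨zero_le_one, le_rfl⟩ 0).mono (Icc_subset_Icc_left (by linarith))).add ?_
    simpa using (((hasDerivAt_id (1 : ℝ)).const_sub 1).const_mul ε).hasDerivWithinAt
  have := nonneg_of_isMaxOn_right (by linarith) hd fun t ht => by
    have h1 := hmax t ht 0
    have h2 : F (1, 0) = 0 := by simp [hF, hexit]
    simp only [mem_ofPred_eq]
    linarith
  rw [hexit_x] at this
  linarith

/-- Lines on which `W` and its gradient vanish accumulate at the entry. -/
theorem gradient_zero_near_entry (S : IsEllipticSolution W Wx Wy Wxx Wyy P R a b)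
    (hentry : ∀ y, Wy (0, y) = 0 → 0 ≤ Wx (0, y)) (hexit : ∀ y, W (1, y) = 0)
    (hexit_x : ∀ y, Wx (1, y) = 0) (hP : ∀ y, P (1, y) < 0) :
    ∃ x : ℕ → ℝ, (∀ k, x k ∈ Ioo (0 : ℝ) 1) ∧ Filter.Tendsto x Filter.atTop (𝓝 0) ∧
      ∀ k y, Wx (x k, y) = 0 ∧ Wy (x k, y) = 0 := by
  have hW : ∀ x ∈ Icc (0 : ℝ) 1, ∀ y, W (x, y) ≤ 0 := fun x hx y => S.nonpos hentry hexit hx y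
  obtain ⟨x₀, hx₀, y₀, h0⟩ := S.exists_zero_near_exit hW hexit hexit_x hP
  have hmem : ∀ k : ℕ, x₀ * (2 / 3) ^ k ∈ Ioo (0 : ℝ) 1 := fun k =>
    ⟨mul_pos hx₀.1 (by positivity),
      (mul_le_of_le_one_right hx₀.1.le (pow_le_one₀ (by norm_num) (by norm_num))).trans_lt hx₀.2⟩
  have hz : ∀ k : ℕ, ∃ y, W (x₀ * (2 / 3) ^ k, y) = 0 := by
    intro k
    induction k with
    | zero => exact ⟨y₀, by simpa using h0⟩
    | succ k ih =>
      obtain ⟨y, hy⟩ := ih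
      refine ⟨0, ?_⟩
      have hk := hmem k
      have hk' := hmem (k + 1)
      by_contra hne
      have hlt := lt_of_le_of_ne (hW _ ⟨hk'.1.le, hk'.2.le⟩ 0) hne
      have hstep : x₀ * (2 / 3) ^ (k + 1) = x₀ * (2 / 3) ^ k * (2 / 3) := by ring
      have := S.neg_of_neg hW (x₁ := x₀ * (2 / 3) ^ k) (y₁ := y) hlt
        (by rw [hstep, abs_lt]; constructor <;> linarith [hk.1, hk.2])
        (by rw [hstep, abs_lt]; constructor <;> linarith [hk.1, hk.2])
      linarith
  have hline : ∀ (k : ℕ) (y : ℝ), W (x₀ * (2 / 3) ^ k, y) = 0 := by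
    intro k y
    obtain ⟨y', hy'⟩ := hz k
    have hk := hmem k
    by_contra hne
    have hlt := lt_of_le_of_ne (hW _ ⟨hk.1.le, hk.2.le⟩ y) hne
    have := S.neg_of_neg hW (x₁ := x₀ * (2 / 3) ^ k) (y₁ := y') hlt
      (by simpa using hk.1) (by simpa using hk.2)
    linarith
  refine ⟨fun k => x₀ * (2 / 3) ^ k, hmem, ?_, fun k y => ⟨?_, ?_⟩⟩
  · simpa using (tendsto_pow_atTop_nhds_zero_of_lt_one (r := (2 / 3 : ℝ)) (by norm_num)
      (by norm_num)).const_mul x₀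
  · refine IsLocalMax.hasDerivAt_eq_zero ?_ (S.deriv_x_interior (hmem k) y)
    refine Filter.mem_of_superset (Icc_mem_nhds (hmem k).1 (hmem k).2) fun t ht => ?_
    simpa only [mem_ofPred_eq, hline k y] using hW t ht y
  · have hk := hmem k
    refine (S.deriv_y _ ⟨hk.1.le, hk.2.le⟩ y).unique ?_
    simpa only [hline k] using hasDerivAt_const y (0 : ℝ)

end IsEllipticSolution

theorem uniqueDiffOn_nozzle : UniqueDiffOn ℝ nozzle :=
  (uniqueDiffOn_Icc zero_lt_one).prod uniqueDiffOn_univ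

theorem mem_nozzle {x : ℝ} (hx : x ∈ Icc (0 : ℝ) 1) (y : ℝ) : (x, y) ∈ nozzle := ⟨hx, mem_univ _⟩

theorem nozzle_subset_closure_interior : nozzle ⊆ closure (interior nozzle) := by
  have : interior nozzle = Ioo (0 : ℝ) 1 ×ˢ univ := by
    rw [nozzle, interior_prod_eq, interior_Icc, interior_univ]
  rw [this, closure_prod_eq, closure_Ioo zero_ne_one, closure_univ, nozzle]

theorem hasDerivWithinAt_pd1 {ψ : ℝ × ℝ → ℝ} (hψ : DifferentiableOn ℝ ψ nozzle) {x : ℝ}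
    (hx : x ∈ Icc (0 : ℝ) 1) (y : ℝ) :
    HasDerivWithinAt (fun t => ψ (t, y)) (pd1 ψ (x, y)) (Icc 0 1) x :=
  (hψ _ (mem_nozzle hx y)).hasFDerivWithinAt.comp_hasDerivWithinAt (f := fun t => (t, y)) x
    ((hasDerivAt_id x).prodMk (hasDerivAt_const x y)).hasDerivWithinAt fun _ ht => mem_nozzle ht y

theorem hasDerivAt_pd2 {ψ : ℝ × ℝ → ℝ} (hψ : DifferentiableOn ℝ ψ nozzle) {x : ℝ}
    (hx : x ∈ Icc (0 : ℝ) 1) (y : ℝ) : HasDerivAt (fun t => ψ (x, t)) (pd2 ψ (x, y)) y := by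
  rw [← hasDerivWithinAt_univ]
  exact (hψ _ (mem_nozzle hx y)).hasFDerivWithinAt.comp_hasDerivWithinAt (f := fun t => (x, t)) y
    ((hasDerivAt_const y x).prodMk (hasDerivAt_id y)).hasDerivWithinAt fun t _ => mem_nozzle hx t

theorem contDiffOn_pd1 {ψ : ℝ × ℝ → ℝ} {k : WithTop ℕ∞} (hψ : ContDiffOn ℝ (k + 1) ψ nozzle) :
    ContDiffOn ℝ k (pd1 ψ) nozzle :=
  (hψ.fderivWithin uniqueDiffOn_nozzle le_rfl).clm_apply contDiffOn_const

theorem contDiffOn_pd2 {ψ : ℝ × ℝ → ℝ} {k : WithTop ℕ∞} (hψ : ContDiffOn ℝ (k + 1) ψ nozzle) :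
    ContDiffOn ℝ k (pd2 ψ) nozzle :=
  (hψ.fderivWithin uniqueDiffOn_nozzle le_rfl).clm_apply contDiffOn_const

theorem pd2_pd1_eq_pd12 {φ : ℝ × ℝ → ℝ} (hφ : ContDiffOn ℝ 2 φ nozzle) {p : ℝ × ℝ}
    (hp : p ∈ nozzle) : pd2 (pd1 φ) p = pd12 φ p := by
  have hd : DifferentiableWithinAt ℝ (fderivWithin ℝ φ nozzle) nozzle p :=
    (hφ.fderivWithin uniqueDiffOn_nozzle (m := 1) (by norm_num)).differentiableOn one_ne_zero p hp
  have hu := uniqueDiffOn_nozzle p hp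
  have key : ∀ v w : ℝ × ℝ, fderivWithin ℝ (fun q => fderivWithin ℝ φ nozzle q v) nozzle p w =
      fderivWithin ℝ (fderivWithin ℝ φ nozzle) nozzle p w v := fun v w => by
    rw [fderivWithin_clm_apply hu hd (differentiableWithinAt_const v)]
    simp
  have hsymm := (hφ p hp).isSymmSndFDerivWithinAt (by simp) uniqueDiffOn_nozzle
    (nozzle_subset_closure_interior hp) hp
  exact (key _ _).trans ((hsymm _ _).trans (key _ _).symm)

/-- The subsonic branch of `q ^ (γ - 1) * (c₀ - (γ - 1) / 2 * q ^ 2)` can be inverted. -/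
theorem exists_subsonic_inverse {γ c₀ b₁ : ℝ} (hγ : 1 < γ) (hb₁ : 0 < b₁)
    (hc : (γ + 1) / 2 * b₁ ^ 2 = c₀) :
    StrictMonoOn (fun q : ℝ => q ^ (γ - 1) * (c₀ - (γ - 1) / 2 * q ^ 2)) (Icc 0 b₁) ∧
    (∀ q > 0, HasDerivAt (fun q : ℝ => q ^ (γ - 1) * (c₀ - (γ - 1) / 2 * q ^ 2))
      ((γ - 1) * (q ^ (γ - 1) / q) * (c₀ - (γ + 1) / 2 * q ^ 2)) q) ∧
    ∃ ψ : ℝ → ℝ, (∀ s ∈ Icc 0 (b₁ ^ (γ + 1)), ψ s ∈ Icc 0 b₁ ∧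
      ψ s ^ (γ - 1) * (c₀ - (γ - 1) / 2 * ψ s ^ 2) = s) ∧
      ContinuousOn ψ (Icc 0 (b₁ ^ (γ + 1))) := by
  set g : ℝ → ℝ := fun q => q ^ (γ - 1) * (c₀ - (γ - 1) / 2 * q ^ 2) with hg
  have hder : ∀ q > 0, HasDerivAt g
      ((γ - 1) * (q ^ (γ - 1) / q) * (c₀ - (γ + 1) / 2 * q ^ 2)) q := fun q hq => by
    have := (Real.hasDerivAt_rpow_const (p := γ - 1) (Or.inl hq.ne')).mul
      (((hasDerivAt_pow 2 q).const_mul ((γ - 1) / 2)).const_sub c₀)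
    refine this.congr_deriv ?_
    rw [Real.rpow_sub_one hq.ne']
    field_simp
    push_cast
    ring
  have hcont : Continuous g :=
    (Real.continuous_rpow_const (by linarith)).mul (by fun_prop)
  have hmono : StrictMonoOn g (Icc 0 b₁) := by
    refine strictMonoOn_of_deriv_pos (convex_Icc _ _) hcont.continuousOn fun q hq => ?_
    rw [interior_Icc] at hq
    rw [(hder q hq.1).deriv]
    have h1 : 0 < c₀ - (γ + 1) / 2 * q ^ 2 := by
      have : q ^ 2 < b₁ ^ 2 := pow_lt_pow_left₀ hq.2 hq.1.le two_ne_zero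
      nlinarith
    have h2 : 0 < γ - 1 := by linarith
    have h3 := hq.1
    positivity
  have hg0 : g 0 = 0 := by simp [hg, Real.zero_rpow (by linarith : γ - 1 ≠ 0)]
  have hg1 : g b₁ = b₁ ^ (γ + 1) := by
    have h1 : c₀ - (γ - 1) / 2 * b₁ ^ 2 = b₁ ^ (2 : ℝ) := by
      rw [Real.rpow_two]; linarith
    simp only [hg]
    rw [h1, ← Real.rpow_add hb₁]
    congr 1
    ring
  have hsurj : ∀ s ∈ Icc 0 (b₁ ^ (γ + 1)), ∃ q ∈ Icc 0 b₁, g q = s := fun s hs => by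
    rw [← hg0, ← hg1] at hs
    exact intermediate_value_Icc hb₁.le hcont.continuousOn hs
  choose! ψ hψ using hsurj
  refine ⟨hmono, hder, ψ, hψ, fun s hs => tendsto_order.2 ⟨fun q hq => ?_, fun q hq => ?_⟩⟩
  · by_cases hq0 : 0 ≤ q
    · have hqm : q ∈ Icc 0 b₁ := ⟨hq0, hq.le.trans (hψ s hs).1.2⟩
      have h1 : g q < s := by
        rw [← (hψ s hs).2]; exact hmono hqm (hψ s hs).1 hq
      filter_upwards [self_mem_nhdsWithin, mem_nhdsWithin_of_mem_nhds (Ioi_mem_nhds h1)]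
        with t ht h2
      rw [mem_Ioi, ← (hψ t ht).2] at h2
      exact (hmono.lt_iff_lt hqm (hψ t ht).1).1 h2
    · filter_upwards [self_mem_nhdsWithin] with t ht
      linarith [(hψ t ht).1.1]
  · by_cases hq1 : q ≤ b₁
    · have hqm : q ∈ Icc 0 b₁ := ⟨(hψ s hs).1.1.trans hq.le, hq1⟩
      have h1 : s < g q := by
        rw [← (hψ s hs).2]; exact hmono (hψ s hs).1 hqm hq
      filter_upwards [self_mem_nhdsWithin, mem_nhdsWithin_of_mem_nhds (Iio_mem_nhds h1)]
        with t ht h2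
      rw [mem_Iio, ← (hψ t ht).2] at h2
      exact (hmono.lt_iff_lt (hψ t ht).1 hqm).1 h2
    · filter_upwards [self_mem_nhdsWithin] with t ht
      linarith [(hψ t ht).1.2]

/-- Velocity of the symmetric subsonic–sonic flow. -/
theorem exists_symmetric_velocity {γ c₀ b₀ b₁ : ℝ} {n : ℝ → ℝ} (hγ : 1 < γ) (hb₁ : 0 < b₁)
    (hc : (γ + 1) / 2 * b₁ ^ 2 = c₀) (hn : Differentiable ℝ n)
    (hnpos : ∀ t ∈ Icc (0 : ℝ) 1, 0 < n t) (hn' : ∀ t ∈ Ioo (0 : ℝ) 1, deriv n t < 0)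
    (hn1 : n 1 = 1) (hb₀pos : 0 < b₀) (hb₀lt : b₀ < b₁)
    (hb₀eq : b₀ ^ (γ - 1) * (c₀ - (γ - 1) / 2 * b₀ ^ 2) * (n 0) ^ (γ - 1) = b₁ ^ (γ + 1)) :
    ∃ U U' : ℝ → ℝ, Continuous U ∧ U 0 = b₀ ∧ U 1 = b₁ ∧ (∀ x ∈ Icc (0 : ℝ) 1, 0 < U x) ∧
      (∀ x ∈ Ico (0 : ℝ) 1, U x < b₁) ∧ ∀ x ∈ Ioo (0 : ℝ) 1, HasDerivAt U (U' x) x ∧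
        n x * (c₀ - (γ + 1) / 2 * U x ^ 2) * U' x +
          deriv n x * (c₀ - (γ - 1) / 2 * U x ^ 2) * U x = 0 := by
  obtain ⟨hmono, hder, ψ, hψ, hψc⟩ := exists_subsonic_inverse hγ hb₁ hc
  set g : ℝ → ℝ := fun q => q ^ (γ - 1) * (c₀ - (γ - 1) / 2 * q ^ 2) with hg
  set G := b₁ ^ (γ + 1) with hG
  have hGpos : 0 < G := Real.rpow_pos_of_pos hb₁ _
  have hγ0 : 0 < γ - 1 := by linarith
  have hanti : StrictAntiOn n (Icc 0 1) :=
    strictAntiOn_of_deriv_neg (convex_Icc _ _) hn.continuous.continuousOn (by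
      rw [interior_Icc]; exact hn')
  set σ : ℝ → ℝ := fun x => G / n x ^ (γ - 1) with hσ
  have hσpos : ∀ x ∈ Icc (0 : ℝ) 1, 0 < σ x := fun x hx =>
    div_pos hGpos (Real.rpow_pos_of_pos (hnpos x hx) _)
  have hσlt : ∀ x ∈ Ico (0 : ℝ) 1, σ x < G := fun x hx => by
    have h1 : 1 < n x := hn1 ▸ hanti ⟨hx.1, hx.2.le⟩ ⟨zero_le_one, le_rfl⟩ hx.2
    exact div_lt_self hGpos (Real.one_lt_rpow h1 hγ0)
  have hσ1 : σ 1 = G := by simp [hσ, hn1]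
  have hσmem : ∀ x ∈ Icc (0 : ℝ) 1, σ x ∈ Icc 0 G := fun x hx => by
    refine ⟨(hσpos x hx).le, ?_⟩
    rcases hx.2.eq_or_lt with rfl | h
    · exact hσ1.le
    · exact (hσlt x ⟨hx.1, h⟩).le
  have hσc : ContinuousOn σ (Icc 0 1) := continuousOn_const.div
    (hn.continuous.continuousOn.rpow_const fun x _ => Or.inr hγ0.le)
    fun x hx => (Real.rpow_pos_of_pos (hnpos x hx) _).ne'
  set r : ℝ → ℝ := fun x => max 0 (min x 1) with hr
  have hrmem : ∀ x, r x ∈ Icc (0 : ℝ) 1 := fun x =>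
    ⟨le_max_left _ _, max_le zero_le_one (min_le_right _ _)⟩
  have hrid : ∀ x ∈ Icc (0 : ℝ) 1, r x = x := fun x hx => by
    simp [hr, hx.1, hx.2]
  have hgb₁ : g b₁ = G := by
    have h1 : c₀ - (γ - 1) / 2 * b₁ ^ 2 = b₁ ^ (2 : ℝ) := by
      rw [Real.rpow_two]; linarith
    simp only [hg]
    rw [h1, ← Real.rpow_add hb₁, hG]
    congr 1
    ring
  have hinv : ∀ q ∈ Icc 0 b₁, ∀ s ∈ Icc 0 G, g q = s → ψ s = q := fun q hq s hs h =>
    hmono.injOn (hψ s hs).1 hq ((hψ s hs).2.trans h.symm)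
  have hψpos : ∀ x ∈ Icc (0 : ℝ) 1, 0 < ψ (σ x) := fun x hx => by
    obtain ⟨h1, h2⟩ := hψ _ (hσmem x hx)
    refine lt_of_le_of_ne h1.1 fun h => ?_
    rw [← h, Real.zero_rpow hγ0.ne', zero_mul] at h2
    exact (hσpos x hx).ne h2
  have hψlt : ∀ x ∈ Ico (0 : ℝ) 1, ψ (σ x) < b₁ := fun x hx => by
    obtain ⟨h1, h2⟩ := hψ _ (hσmem x ⟨hx.1, hx.2.le⟩)
    refine lt_of_le_of_ne h1.2 fun h => (hσlt x hx).ne ?_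
    rw [← h2, h]
    exact hgb₁
  refine ⟨fun x => ψ (σ (r x)), fun x => -(deriv n x * (c₀ - (γ - 1) / 2 * ψ (σ x) ^ 2) * ψ (σ x)) /
    (n x * (c₀ - (γ + 1) / 2 * ψ (σ x) ^ 2)), ?_, ?_, ?_, fun x hx => ?_, fun x hx => ?_,
    fun x hx => ?_⟩
  · exact hψc.comp_continuous (hσc.comp_continuous (by fun_prop) hrmem) fun x => hσmem _ (hrmem x)
  · have h0 : (0 : ℝ) ∈ Icc (0 : ℝ) 1 := ⟨le_rfl, zero_le_one⟩
    simp only [hrid 0 h0]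
    refine hinv b₀ ⟨hb₀pos.le, hb₀lt.le⟩ _ (hσmem 0 h0) ?_
    rw [hσ, eq_div_iff (Real.rpow_pos_of_pos (hnpos 0 h0) _).ne']
    exact hb₀eq
  · have h1 : (1 : ℝ) ∈ Icc (0 : ℝ) 1 := ⟨zero_le_one, le_rfl⟩
    simp only [hrid 1 h1]
    exact hinv b₁ ⟨hb₁.le, le_rfl⟩ _ (hσmem 1 h1) (hgb₁.trans hσ1.symm)
  · simpa only [hrid x hx] using hψpos x hx
  · simpa only [hrid x ⟨hx.1, hx.2.le⟩] using hψlt x hx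
  · have hxc : x ∈ Icc (0 : ℝ) 1 := ⟨hx.1.le, hx.2.le⟩
    have hq0 := hψpos x hxc
    have hq1 := hψlt x ⟨hx.1.le, hx.2⟩
    have hs0 := hσpos x hxc
    have hs1 := hσlt x ⟨hx.1.le, hx.2⟩
    have hnx := hnpos x hxc
    have hval := (hψ _ (hσmem x hxc)).2
    have hD : 0 < c₀ - (γ + 1) / 2 * ψ (σ x) ^ 2 := by
      have : ψ (σ x) ^ 2 < b₁ ^ 2 := pow_lt_pow_left₀ hq1 hq0.le two_ne_zero
      nlinarith
    have hw : 0 < ψ (σ x) ^ (γ - 1) := Real.rpow_pos_of_pos hq0 _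
    have hψd : HasDerivAt ψ
        ((γ - 1) * (ψ (σ x) ^ (γ - 1) / ψ (σ x)) * (c₀ - (γ + 1) / 2 * ψ (σ x) ^ 2))⁻¹ (σ x) :=
      HasDerivAt.of_local_left_inverse (hψc.continuousAt (Icc_mem_nhds hs0 hs1))
        (hder _ hq0) (by positivity)
        (Filter.mem_of_superset (Icc_mem_nhds hs0 hs1) fun s hs => (hψ s hs).2)
    have hσd : HasDerivAt σ (-(γ - 1) * σ x * deriv n x / n x) x := by
      have h1 := (hn x).hasDerivAt.rpow_const (p := γ - 1) (Or.inl hnx.ne')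
      have hne : n x ^ (γ - 1) ≠ 0 := (Real.rpow_pos_of_pos hnx _).ne'
      refine ((hasDerivAt_const x G).div h1 hne).congr_deriv ?_
      rw [Real.rpow_sub_one hnx.ne' (γ - 1)]
      simp only [hσ]
      generalize n x ^ (γ - 1) = w at hne ⊢
      field_simp
      ring
    have hev : (fun x => ψ (σ (r x))) =ᶠ[𝓝 x] fun x => ψ (σ x) :=
      Filter.mem_of_superset (Icc_mem_nhds hx.1 hx.2) fun t ht => by
        simp only [mem_ofPred_eq, hrid t ht]
    constructor
    · refine ((hψd.comp x hσd).congr_of_eventuallyEq hev).congr_deriv ?_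
      conv_lhs => rw [show -(γ - 1) * σ x = -(γ - 1) * (ψ (σ x) ^ (γ - 1) *
        (c₀ - (γ - 1) / 2 * ψ (σ x) ^ 2)) by rw [hval]]
      have hD' := hD.ne'
      field_simp
    · simp only [hrid x hxc]
      have h := mul_div_cancel₀ (-(deriv n x * (c₀ - (γ - 1) / 2 * ψ (σ x) ^ 2) * ψ (σ x)))
        (mul_pos hnx hD).ne'
      linarith

theorem continuous_deriv_of_contDiff {n : ℝ → ℝ} (hn : ContDiff ℝ (⊤ : ℕ∞) n) :
    Continuous (deriv n) :=
  hn.continuous_deriv (by simp)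

section Flow

variable {γ c₀ b₀ b₁ : ℝ} {n : ℝ → ℝ} {φ : ℝ × ℝ → ℝ}

theorem continuousOn_pd1 (hφ : ContDiffOn ℝ 2 φ nozzle) : ContinuousOn (pd1 φ) nozzle :=
  (contDiffOn_pd1 (k := 1) (by simpa [one_add_one_eq_two] using hφ)).continuousOn

theorem continuousOn_pd2 (hφ : ContDiffOn ℝ 2 φ nozzle) : ContinuousOn (pd2 φ) nozzle :=
  (contDiffOn_pd2 (k := 1) (by simpa [one_add_one_eq_two] using hφ)).continuousOn

theorem differentiableOn_pd1 (hφ : ContDiffOn ℝ 2 φ nozzle) :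
    DifferentiableOn ℝ (pd1 φ) nozzle :=
  (contDiffOn_pd1 (k := 1) (by simpa [one_add_one_eq_two] using hφ)).differentiableOn one_ne_zero

theorem differentiableOn_pd2 (hφ : ContDiffOn ℝ 2 φ nozzle) :
    DifferentiableOn ℝ (pd2 φ) nozzle :=
  (contDiffOn_pd2 (k := 1) (by simpa [one_add_one_eq_two] using hφ)).differentiableOn one_ne_zero

theorem continuousOn_pd11 (hφ : ContDiffOn ℝ 2 φ nozzle) : ContinuousOn (pd11 φ) nozzle :=
  (contDiffOn_pd1 (k := 0) (by
    simpa using contDiffOn_pd1 (k := 1) (by simpa [one_add_one_eq_two] using hφ))).continuousOn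

theorem continuousOn_pd12 (hφ : ContDiffOn ℝ 2 φ nozzle) : ContinuousOn (pd12 φ) nozzle :=
  (contDiffOn_pd1 (k := 0) (by
    simpa using contDiffOn_pd2 (k := 1) (by simpa [one_add_one_eq_two] using hφ))).continuousOn

theorem continuousOn_pd22 (hφ : ContDiffOn ℝ 2 φ nozzle) : ContinuousOn (pd22 φ) nozzle :=
  (contDiffOn_pd2 (k := 0) (by
    simpa using contDiffOn_pd2 (k := 1) (by simpa [one_add_one_eq_two] using hφ))).continuousOn

theorem pd2_periodic (hφ : DifferentiableOn ℝ φ nozzle) {T x : ℝ}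
    (hper : ∀ x y : ℝ, φ (x, y + T) = φ (x, y)) (hx : x ∈ Icc (0 : ℝ) 1) (y : ℝ) :
    pd2 φ (x, y + T) = pd2 φ (x, y) := by
  have h := (hasDerivAt_pd2 hφ hx (y + T)).comp_add_const y T
  simp only [hper] at h
  exact h.unique (hasDerivAt_pd2 hφ hx y)

/-- The potential flow equation extends to the entry and the exit by continuity. -/
theorem potentialFlowEq_nozzle (hφ : ContDiffOn ℝ 2 φ nozzle) (hn : ContDiff ℝ (⊤ : ℕ∞) n)
    (hnpos : ∀ t ∈ Icc (0 : ℝ) 1, 0 < n t)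
    (hpde : ∀ p ∈ Ioo (0 : ℝ) 1 ×ˢ (univ : Set ℝ), PotentialFlowEq γ c₀ n φ p)
    {p : ℝ × ℝ} (hp : p ∈ nozzle) : PotentialFlowEq γ c₀ n φ p := by
  have h1 := continuousOn_pd1 hφ
  have h2 := continuousOn_pd2 hφ
  have h11 := continuousOn_pd11 hφ
  have h12 := continuousOn_pd12 hφ
  have h22 := continuousOn_pd22 hφ
  have hnc := hn.continuous
  have hn'c := continuous_deriv_of_contDiff hn
  have hne : ∀ p ∈ nozzle, n p.1 ^ 2 ≠ 0 := fun p hp => (pow_pos (hnpos _ hp.1) 2).ne'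
  have hc : ContinuousOn (soundSq γ c₀ n φ) nozzle := by
    unfold soundSq
    fun_prop (disch := assumption)
  refine EqOn.of_subset_closure (s := Ioo (0 : ℝ) 1 ×ˢ univ) (t := nozzle) (g := fun _ => 0) hpde
    ?_ continuousOn_const (prod_mono Ioo_subset_Icc_self subset_rfl) ?_ hp
  · fun_prop (disch := assumption)
  · rw [closure_prod_eq, closure_Ioo zero_ne_one, closure_univ, nozzle]

/-- At a sonic exit at which the flow accelerates, the flow is symmetric. -/
theorem exit_symmetric (hφ : ContDiffOn ℝ 2 φ nozzle)
    (hper : ∀ x y : ℝ, φ (x, y + 2 * Real.pi) = φ (x, y)) (hb₁ : 0 < b₁)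
    (hc : (γ + 1) / 2 * b₁ ^ 2 = c₀) (hn1 : n 1 = 1) (hn'1 : deriv n 1 = 0)
    (hpde : ∀ y, PotentialFlowEq γ c₀ n φ (1, y)) (hu : ∀ y : ℝ, 0 ≤ pd1 φ (1, y))
    (hexit : ∀ y : ℝ, pd1 φ (1, y) ^ 2 + pd2 φ (1, y) ^ 2 = b₁ ^ 2)
    (hacc : ∀ y : ℝ, 0 < pd11 φ (1, y)) (y : ℝ) :
    pd1 φ (1, y) = b₁ ∧ pd2 φ (1, y) = 0 ∧ pd22 φ (1, y) = 0 := by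
  have h1 : (1 : ℝ) ∈ Icc (0 : ℝ) 1 := ⟨zero_le_one, le_rfl⟩
  have hv : ∀ y, HasDerivAt (fun t => pd2 φ (1, t)) (pd22 φ (1, y)) y :=
    hasDerivAt_pd2 (differentiableOn_pd2 hφ) h1
  have hu' : ∀ y, HasDerivAt (fun t => pd1 φ (1, t)) (pd12 φ (1, y)) y := fun y =>
    (hasDerivAt_pd2 (differentiableOn_pd1 hφ) h1 y).congr_deriv
      (pd2_pd1_eq_pd12 hφ (mem_nozzle h1 y))
  have hbern : ∀ y, pd1 φ (1, y) * pd12 φ (1, y) + pd2 φ (1, y) * pd22 φ (1, y) = 0 := fun y => by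
    have h := ((hu' y).pow 2).add ((hv y).pow 2)
    have hconst : ((fun t => pd1 φ (1, t)) ^ 2 + (fun t => pd2 φ (1, t)) ^ 2 : ℝ → ℝ) =
        fun _ => b₁ ^ 2 := funext hexit
    rw [hconst] at h
    have := h.unique (hasDerivAt_const y _)
    norm_num at this
    linarith
  have key : ∀ y, pd2 φ (1, y) ^ 2 * pd11 φ (1, y) +
      (b₁ ^ 2 + pd2 φ (1, y) ^ 2) * pd22 φ (1, y) = 0 := fun y => by
    have h := hpde y
    simp only [PotentialFlowEq, soundSq, hn1, hn'1] at h
    norm_num at h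
    rw [hexit y] at h
    have hs : c₀ - (γ - 1) / 2 * b₁ ^ 2 = b₁ ^ 2 := by linarith
    rw [hs] at h
    linear_combination h + 2 * pd2 φ (1, y) * hbern y
      + pd11 φ (1, y) * hexit y
  have hb₁2 : 0 < b₁ ^ 2 := by positivity
  have hanti : Antitone fun t => pd2 φ (1, t) :=
    antitone_of_deriv_nonpos (fun y => (hv y).differentiableAt) fun y => by
      rw [(hv y).deriv]
      by_contra! hpos
      have := mul_pos (add_pos_of_pos_of_nonneg hb₁2 (sq_nonneg (pd2 φ (1, y)))) hpos
      have := mul_nonneg (sq_nonneg (pd2 φ (1, y))) (hacc y).le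
      linarith [key y]
  have hvper : Function.Periodic (fun t => pd2 φ (1, t)) (2 * Real.pi) :=
    pd2_periodic (hφ.differentiableOn two_ne_zero) hper h1
  have hle : ∀ s t, pd2 φ (1, s) ≤ pd2 φ (1, t) := fun s t => by
    obtain ⟨r, hr, hsr⟩ := hvper.exists_mem_Ico Real.two_pi_pos s t
    exact hsr.trans_le (hanti hr.1)
  have hv0 : pd22 φ (1, y) = 0 := by
    have hconst : (fun t => pd2 φ (1, t)) = fun _ => pd2 φ (1, 0) :=
      funext fun t => le_antisymm (hle _ _) (hle _ _)
    have h := hv y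
    rw [hconst] at h
    exact h.unique (hasDerivAt_const y _)
  have hk := key y
  rw [hv0, mul_zero, add_zero, mul_eq_zero, or_iff_left (hacc y).ne'] at hk
  have hv00 : pd2 φ (1, y) = 0 := pow_eq_zero_iff two_ne_zero |>.1 hk
  refine ⟨?_, hv00, hv0⟩
  have := hexit y
  rw [hk, add_zero] at this
  exact (pow_left_inj₀ (hu y) hb₁.le two_ne_zero).1 this

/-- The difference of a potential flow and the symmetric subsonic-sonic flow, multiplied by a
constant, solves a linear elliptic equation. -/
theorem isEllipticSolution_sub (hφ : ContDiffOn ℝ 2 φ nozzle)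
    (hper : ∀ x y : ℝ, φ (x, y + 2 * Real.pi) = φ (x, y)) (hγ : 1 < γ)
    (hc : (γ + 1) / 2 * b₁ ^ 2 = c₀) (hn : ContDiff ℝ (⊤ : ℕ∞) n)
    (hnpos : ∀ t ∈ Icc (0 : ℝ) 1, 0 < n t)
    (hpde : ∀ p ∈ Ioo (0 : ℝ) 1 ×ˢ (univ : Set ℝ), PotentialFlowEq γ c₀ n φ p)
    {U U' : ℝ → ℝ} (hU : Continuous U) (hUpos : ∀ x ∈ Icc (0 : ℝ) 1, 0 < U x)
    (hUlt : ∀ x ∈ Ico (0 : ℝ) 1, U x < b₁)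
    (hode : ∀ x ∈ Ioo (0 : ℝ) 1, HasDerivAt U (U' x) x ∧
      n x * (c₀ - (γ + 1) / 2 * U x ^ 2) * U' x +
        deriv n x * (c₀ - (γ - 1) / 2 * U x ^ 2) * U x = 0) (s : ℝ) :
    IsEllipticSolution
      (fun p => s * (φ p - (∫ t in (1 : ℝ)..p.1, U t) - φ (1, 0)))
      (fun p => s * (pd1 φ p - U p.1)) (fun p => s * pd2 φ p)
      (fun p => s * (pd11 φ p - U' p.1)) (fun p => s * pd22 φ p)
      (fun p => -((γ + 1) / 2) * n p.1 ^ 2 * (pd1 φ p + U p.1) * pd11 φ p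
        - (γ - 1) / 2 * (pd1 φ p + U p.1) * pd22 φ p
        + n p.1 * deriv n p.1 * (c₀ - (γ - 1) / 2 * U p.1 ^ 2
          - (γ - 1) / 2 * pd1 φ p * (pd1 φ p + U p.1)))
      (fun p => -((γ - 1) / 2) * pd2 φ p * pd11 φ p - 2 * pd1 φ p * pd12 φ p
        - (γ + 1) / 2 * (pd2 φ p / n p.1 ^ 2) * pd22 φ p
        + n p.1 * deriv n p.1 * (1 - (γ - 1) / 2) * pd1 φ p * (pd2 φ p / n p.1 ^ 2))
      (fun x => n x ^ 2 * (c₀ - (γ + 1) / 2 * U x ^ 2))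
      (fun x => c₀ - (γ - 1) / 2 * U x ^ 2) := by
  have hd := hφ.differentiableOn two_ne_zero
  have h1 := continuousOn_pd1 hφ
  have h2 := continuousOn_pd2 hφ
  have h11 := continuousOn_pd11 hφ
  have h12 := continuousOn_pd12 hφ
  have h22 := continuousOn_pd22 hφ
  have hφc := hφ.continuousOn
  have hnc := hn.continuous
  have hn'c := continuous_deriv_of_contDiff hn
  have hne : ∀ p ∈ nozzle, n p.1 ^ 2 ≠ 0 := fun p hp => (pow_pos (hnpos _ hp.1) 2).ne'
  have hprim : ∀ x, HasDerivAt (fun x => ∫ t in (1 : ℝ)..x, U t) (U x) x := fun x =>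
    (hU.integral_hasStrictDerivAt 1 x).hasDerivAt
  have hprimc : ContinuousOn (fun p : ℝ × ℝ => ∫ t in (1 : ℝ)..p.1, U t) nozzle :=
    ((continuous_iff_continuousAt.2 fun x => (hprim x).continuousAt).comp
      continuous_fst).continuousOn
  have hUsq : ∀ x ∈ Ico (0 : ℝ) 1, U x ^ 2 < b₁ ^ 2 := fun x hx =>
    pow_lt_pow_left₀ (hUlt x hx) (hUpos x ⟨hx.1, hx.2.le⟩).le two_ne_zero
  constructor
  · fun_prop
  · intro x y
    simp only [hper]
  · intro x hx y
    exact (((hasDerivWithinAt_pd1 hd hx y).sub (hprim x).hasDerivWithinAt).sub_const _).const_mul s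
  · intro x hx y
    exact (((hasDerivAt_pd2 hd hx y).sub_const (∫ t in (1 : ℝ)..x, U t)).sub_const
      (φ (1, 0))).const_mul s
  · intro x hx y
    exact (((hasDerivWithinAt_pd1 (differentiableOn_pd1 hφ) (Ioo_subset_Icc_self hx) y).hasDerivAt
      (Icc_mem_nhds hx.1 hx.2)).sub (hode x hx).1).const_mul s
  · intro x hx y
    exact (hasDerivAt_pd2 (differentiableOn_pd2 hφ) (Ioo_subset_Icc_self hx) y).const_mul s
  · intro x hx y
    have hE := hpde (x, y) ⟨hx, mem_univ _⟩
    have hO := (hode x hx).2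
    have hnx : n x ^ 2 * (n x)⁻¹ ^ 2 = 1 := by
      rw [← mul_pow, mul_inv_cancel₀ (hnpos x (Ioo_subset_Icc_self hx)).ne', one_pow]
    simp only [PotentialFlowEq, soundSq] at hE
    linear_combination s * hE - s * n x * hO
      + s * (γ - 1) / 2 * pd11 φ (x, y) * pd2 φ (x, y) ^ 2 * hnx
  · fun_prop
  · intro x hx
    have := hUsq x hx
    exact mul_pos (pow_pos (hnpos x ⟨hx.1, hx.2.le⟩) 2) (by nlinarith)
  · fun_prop
  · intro x hx
    have := hUsq x hx
    nlinarith [sq_nonneg (U x)]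
  · fun_prop
  · fun_prop (disch := assumption)

/-- A subsonic-sonic flow with one-signed entry perturbation has the symmetric entry data. -/
theorem entry_eq_of_one_signed (hφ : ContDiffOn ℝ 2 φ nozzle)
    (hper : ∀ x y : ℝ, φ (x, y + 2 * Real.pi) = φ (x, y)) (hγ : 1 < γ) (hb₁ : 0 < b₁)
    (hc : (γ + 1) / 2 * b₁ ^ 2 = c₀) (hn : ContDiff ℝ (⊤ : ℕ∞) n)
    (hnpos : ∀ t ∈ Icc (0 : ℝ) 1, 0 < n t) (hn' : ∀ t ∈ Ioo (0 : ℝ) 1, deriv n t < 0)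
    (hn'1 : deriv n 1 = 0) (hn1 : n 1 = 1) (hb₀pos : 0 < b₀) (hb₀lt : b₀ < b₁)
    (hb₀eq : b₀ ^ (γ - 1) * (c₀ - (γ - 1) / 2 * b₀ ^ 2) * (n 0) ^ (γ - 1) = b₁ ^ (γ + 1))
    (hpde : ∀ p ∈ Ioo (0 : ℝ) 1 ×ˢ (univ : Set ℝ), PotentialFlowEq γ c₀ n φ p)
    (hu0 : ∀ y : ℝ, 0 ≤ pd1 φ (0, y)) (hu1 : ∀ y : ℝ, 0 ≤ pd1 φ (1, y)) {B : ℝ → ℝ}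
    (hentry : ∀ y : ℝ, pd1 φ (0, y) ^ 2 + pd2 φ (0, y) ^ 2 / n 0 ^ 2 = B y)
    (hexit : ∀ y : ℝ, pd1 φ (1, y) ^ 2 + pd2 φ (1, y) ^ 2 = b₁ ^ 2)
    (hacc : ∀ y : ℝ, 0 < pd11 φ (1, y)) {s : ℝ} (hs : s ≠ 0)
    (hsign : ∀ y, 0 ≤ s * (B y - b₀ ^ 2)) (y : ℝ) : B y = b₀ ^ 2 := by
  have m0 : (0 : ℝ) ∈ Icc (0 : ℝ) 1 := ⟨le_rfl, zero_le_one⟩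
  have m1 : (1 : ℝ) ∈ Icc (0 : ℝ) 1 := ⟨zero_le_one, le_rfl⟩
  obtain ⟨U, U', hU, hU0, hU1, hUpos, hUlt, hode⟩ := exists_symmetric_velocity hγ hb₁ hc
    (hn.differentiable (by simp)) hnpos hn' hn1 hb₀pos hb₀lt hb₀eq
  have hsymm := exit_symmetric hφ hper hb₁ hc hn1 hn'1
    (fun y => potentialFlowEq_nozzle hφ hn hnpos hpde (mem_nozzle m1 y)) hu1 hexit hacc
  have hφ1 : ∀ y, φ (1, y) = φ (1, 0) := fun y => by
    have hd := fun t => hasDerivAt_pd2 (hφ.differentiableOn two_ne_zero) m1 t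
    exact is_const_of_deriv_eq_zero (f := fun t => φ (1, t))
      (fun t => (hd t).differentiableAt) (fun t => (hd t).deriv.trans (hsymm t).2.1) y 0
  obtain ⟨x, hx, hx0, hgrad⟩ := (isEllipticSolution_sub hφ hper hγ hc hn hnpos hpde hU hUpos hUlt
    hode s).gradient_zero_near_entry
    (fun y hy => by
      have hv : pd2 φ (0, y) = 0 := (mul_eq_zero.1 hy).resolve_left hs
      have hB := hsign y
      rw [← hentry y, hv] at hB
      have hB' : 0 ≤ s * (pd1 φ (0, y) - b₀) * (pd1 φ (0, y) + b₀) := by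
        refine hB.trans_eq ?_
        ring
      rw [hU0]
      exact nonneg_of_mul_nonneg_left hB' (by linarith [hu0 y]))
    (fun y => by simp [hφ1 y])
    (fun y => by simp [(hsymm y).1, hU1])
    (fun y => by
      obtain ⟨e1, -, e3⟩ := hsymm y
      simp only [e1, e3, hU1, hn1, hn'1]
      have := mul_pos (mul_pos (by linarith : 0 < γ + 1) hb₁) (hacc y)
      linarith)
  have hlim : Filter.Tendsto (fun k => (x k, y)) Filter.atTop (𝓝[nozzle] (0, y)) :=
    tendsto_nhdsWithin_iff.2 ⟨hx0.prodMk_nhds tendsto_const_nhds,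
      Filter.Eventually.of_forall fun k => mem_nozzle (Ioo_subset_Icc_self (hx k)) y⟩
  have hv : pd2 φ (0, y) = 0 := by
    have h := (continuousOn_pd2 hφ _ (mem_nozzle m0 y)).tendsto.comp hlim
    refine tendsto_nhds_unique h (tendsto_const_nhds.congr fun k => ?_)
    exact ((mul_eq_zero.1 (hgrad k y).2).resolve_left hs).symm
  have hu : pd1 φ (0, y) = b₀ := by
    have h := (continuousOn_pd1 hφ _ (mem_nozzle m0 y)).tendsto.comp hlim
    rw [← hU0]
    refine tendsto_nhds_unique h (((hU.tendsto 0).comp hx0).congr fun k => ?_)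
    exact (sub_eq_zero.1 ((mul_eq_zero.1 (hgrad k y).1).resolve_left hs)).symm
  rw [← hentry y, hu, hv]
  ring

end Flow

/-- Instability of the symmetric subsonic–sonic flow: if the Bernoulli entry
datum `B(y)` is a positive 2π-periodic one-signed perturbation of `b₀²` not identically
equal to `b₀²`, then there is no `C²` solution of the potential flow equation with the
perturbed entry condition, the sonic exit condition, `∂₁φ ≥ 0` on the entry and exit,
and acceleration `∂₁₁φ > 0` at the exit. -/
theorem instability_subsonic_sonic_flow
    (γ c₀ : ℝ) (hγ : 1 < γ) (hc₀ : 0 < c₀)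
    (n : ℝ → ℝ) (hn : ContDiff ℝ (⊤ : ℕ∞) n)
    (hnpos : ∀ t ∈ Icc (0:ℝ) 1, 0 < n t)
    (hn'' : ∀ t ∈ Icc (0:ℝ) 1, 0 < deriv (deriv n) t)
    (hn' : ∀ t ∈ Ioo (0:ℝ) 1, deriv n t < 0)
    (hn'1 : deriv n 1 = 0) (hn1 : n 1 = 1)
    (b₁ : ℝ) (hb₁ : b₁ = Real.sqrt (2 * c₀ / (γ + 1)))
    (b₀ : ℝ) (hb₀pos : 0 < b₀) (hb₀lt : b₀ < b₁)
    (hb₀eq : b₀ ^ (γ - 1) * (c₀ - (γ - 1) / 2 * b₀ ^ 2) * (n 0) ^ (γ - 1) = b₁ ^ (γ + 1))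
    -- B is a positive, 2π-periodic, one-signed perturbation of b₀², not identically b₀²
    (B : ℝ → ℝ) (hBpos : ∀ y, 0 < B y) (hBper : ∀ y, B (y + 2 * Real.pi) = B y)
    (hBne : ¬ (∀ y, B y = b₀ ^ 2))
    (hBsign : (∀ y, b₀ ^ 2 ≤ B y) ∨ (∀ y, B y ≤ b₀ ^ 2)) :
    ¬ ∃ φ : ℝ × ℝ → ℝ,
      ContDiffOn ℝ 2 φ nozzle ∧
      (∀ x y : ℝ, φ (x, y + 2 * Real.pi) = φ (x, y)) ∧
      (∀ p ∈ Ioo (0:ℝ) 1 ×ˢ (Set.univ : Set ℝ), PotentialFlowEq γ c₀ n φ p) ∧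
      (∀ y : ℝ, 0 ≤ pd1 φ (0, y)) ∧ (∀ y : ℝ, 0 ≤ pd1 φ (1, y)) ∧
      (∀ y : ℝ, (pd1 φ (0, y)) ^ 2 + (pd2 φ (0, y)) ^ 2 / (n 0) ^ 2 = B y) ∧
      (∀ y : ℝ, (pd1 φ (1, y)) ^ 2 + (pd2 φ (1, y)) ^ 2 = b₁ ^ 2) ∧
      (∀ y : ℝ, 0 < pd11 φ (1, y)) := by

  rintro ⟨φ, hφ, hper, hpde, hu0, hu1, hentry, hexit, hacc⟩
  have hb₁pos : 0 < b₁ := hb₀pos.trans hb₀lt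
  have hc : (γ + 1) / 2 * b₁ ^ 2 = c₀ := by
    rw [hb₁, Real.sq_sqrt (by positivity)]
    field_simp
  have key := fun {s : ℝ} (hs : s ≠ 0) => entry_eq_of_one_signed hφ hper hγ hb₁pos hc hn hnpos hn'
    hn'1 hn1 hb₀pos hb₀lt hb₀eq hpde hu0 hu1 hentry hexit hacc hs
  refine hBne (hBsign.elim (fun h => key one_ne_zero fun y => ?_)
    fun h => key (neg_ne_zero.2 one_ne_zero) fun y => ?_)
  · linarith [h y]
  · linarith [h y]
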